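/- (Cryptographic core of Theorem 1, condition 2, and Theorem 2, condition 1: an honest shared first anonymizing router hides which of two consumers sent which doubly-encrypted interest, even when the inner keys and plaintexts are known.) Let the outer scheme (Gen1, Enc1, Dec1) over PK1, SK1, M1, C1 be ε-CPA-secure, with message type M1 equal to the ciphertext type C2 of an inner scheme (Gen2, Enc2, Dec2). Fix inner public keys pk2, pk2' : PK2 and messages m, m' : M2. In the experiment where (pk1, sk1) ← Gen1, x ← Enc2 pk2 m, x' ← Enc2 pk2' m', c ← Enc1 pk1 x, c' ← Enc1 pk1 x', b is drawn uniformly from Bool, and the adversary observes pk1 together with the ordered pair (c, c') if b = false and (c', c) if b = true, every adversary D : PK1 × C1 × C1 → Bool satisfies |Pr[D = b] − 1/2| ≤ ε. (An adversary additionally knowing pk2, pk2', m, m', and the inner secret keys is covered, since these are fixed parameters of the experiment.) -/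

import Mathlib

/-- CPA distinguishing advantage of a distinguisher `g : PK × C → Bool` against a
public-key encryption scheme with key generation `Gen` and encryption `Enc`,
on the pair of messages `m0, m1`. -/
noncomputable def cpaAdv {PK SK M C : Type*} (Gen : PMF (PK × SK)) (Enc : PK → M → PMF C)
    (g : PK × C → Bool) (m0 m1 : M) : ℝ :=
  |(((Gen.bind fun ks => (Enc ks.1 m1).map fun c => g (ks.1, c))) true).toReal -
   (((Gen.bind fun ks => (Enc ks.1 m0).map fun c => g (ks.1, c))) true).toReal|

/-- A public-key encryption scheme is `ε`-CPA-secure if every distinguisher on every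
pair of messages has CPA distinguishing advantage at most `ε`. -/
def CPASecure {PK SK M C : Type*} (Gen : PMF (PK × SK)) (Enc : PK → M → PMF C)
    (ε : ℝ) : Prop :=
  ∀ (m0 m1 : M) (g : PK × C → Bool), cpaAdv Gen Enc g m0 m1 ≤ ε

namespace PMF

theorem toReal_bind_apply {α β : Type*} (p : PMF α) (k : α → PMF β) (b : β) :
    ((p.bind k) b).toReal = ∑' a, (p a).toReal * (k a b).toReal := by
  rw [PMF.bind_apply, ENNReal.tsum_toReal_eq]
  · simp only [ENNReal.toReal_mul]
  · exact fun a => ENNReal.mul_ne_top (p.apply_ne_top a) ((k a).apply_ne_top b)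

theorem toReal_apply_nonneg_le_one {α : Type*} (p : PMF α) (a : α) :
    0 ≤ (p a).toReal ∧ (p a).toReal ≤ 1 :=
  ⟨ENNReal.toReal_nonneg, ENNReal.toReal_le_of_le_ofReal zero_le_one (by simpa using p.coe_le_one a)⟩

theorem summable_toReal {α : Type*} (p : PMF α) : Summable fun a => (p a).toReal :=
  ENNReal.summable_toReal p.tsum_coe_ne_top

theorem tsum_toReal {α : Type*} (p : PMF α) : ∑' a, (p a).toReal = 1 := by
  rw [← ENNReal.tsum_toReal_eq p.apply_ne_top, p.tsum_coe, ENNReal.toReal_one]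

theorem summable_toReal_mul {α β : Type*} (p : PMF α) (k : α → PMF β) (b : β) :
    Summable fun a => (p a).toReal * (k a b).toReal :=
  Summable.of_nonneg_of_le
    (fun _ => mul_nonneg ENNReal.toReal_nonneg ENNReal.toReal_nonneg)
    (fun a => mul_le_of_le_one_right ENNReal.toReal_nonneg ((k a).toReal_apply_nonneg_le_one b).2)
    p.summable_toReal

/-- A deterministic test (the likelihood-ratio test) distinguishes two distributions at least as
well as a given randomized test. -/
theorem exists_map_sub_ge_bind_sub {α : Type*} (p q : PMF α) (k : α → PMF Bool) :
    ∃ g : α → Bool, ((p.bind k) true).toReal - ((q.bind k) true).toReal ≤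
      ((p.map g) true).toReal - ((q.map g) true).toReal := by
  classical
  refine ⟨fun a => decide (q a < p a), ?_⟩
  simp only [← PMF.bind_pure_comp, toReal_bind_apply]
  rw [← (p.summable_toReal_mul _ _).tsum_sub (q.summable_toReal_mul _ _),
    ← (p.summable_toReal_mul _ _).tsum_sub (q.summable_toReal_mul _ _)]
  refine Summable.tsum_le_tsum (fun a => ?_)
    ((p.summable_toReal_mul _ _).sub (q.summable_toReal_mul _ _))
    ((p.summable_toReal_mul _ _).sub (q.summable_toReal_mul _ _))
  have hk := (k a).toReal_apply_nonneg_le_one true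
  by_cases h : q a < p a
  · have h_lt := (ENNReal.toReal_lt_toReal (q.apply_ne_top a) (p.apply_ne_top a)).2 h
    simp [h]
    nlinarith
  · have h_le := (ENNReal.toReal_le_toReal (p.apply_ne_top a) (q.apply_ne_top a)).2 (not_lt.1 h)
    simp [h]
    nlinarith

/-- Averaging preserves a uniform bound on the deviation of a probability from a constant. -/
theorem abs_toReal_bind_apply_sub_le {α β : Type*} (p : PMF α) (k : α → PMF β) (b : β) {r ε : ℝ}
    (h : ∀ a, |(k a b).toReal - r| ≤ ε) : |((p.bind k) b).toReal - r| ≤ ε := by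
  have hs := p.summable_toReal_mul k b
  have hc (t : ℝ) : ∑' a, (p a).toReal * t = t := by rw [tsum_mul_right, p.tsum_toReal, one_mul]
  have hle := hs.tsum_le_tsum (fun a => mul_le_mul_of_nonneg_left
    (show (k a b).toReal ≤ r + ε by linarith [(abs_le.1 (h a)).2]) ENNReal.toReal_nonneg)
    (p.summable_toReal.mul_right _)
  have hge := (p.summable_toReal.mul_right (r - ε)).tsum_le_tsum
    (fun a => mul_le_mul_of_nonneg_left
      (show r - ε ≤ (k a b).toReal by linarith [(abs_le.1 (h a)).1]) ENNReal.toReal_nonneg) hs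
  rw [hc] at hle hge
  rw [toReal_bind_apply, abs_le]
  constructor <;> linarith

theorem toReal_map_not_true (p : PMF Bool) : ((p.map not) true).toReal = 1 - (p true).toReal := by
  have h := p.tsum_toReal
  rw [tsum_bool] at h
  rw [← PMF.bind_pure_comp, toReal_bind_apply, tsum_bool]
  simp
  linarith

end PMF

/-- CPA security bounds the advantage of randomized distinguishers as well. -/
theorem CPASecure.abs_bind_sub_le {PK SK M C : Type*} {Gen : PMF (PK × SK)}
    {Enc : PK → M → PMF C} {ε : ℝ} (h : CPASecure Gen Enc ε) (k : PK → C → PMF Bool) (m0 m1 : M) :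
    |((Gen.bind fun ks => (Enc ks.1 m1).bind (k ks.1)) true).toReal -
      ((Gen.bind fun ks => (Enc ks.1 m0).bind (k ks.1)) true).toReal| ≤ ε := by
  let P (m : M) : PMF (PK × C) := Gen.bind fun ks => (Enc ks.1 m).map (Prod.mk ks.1)
  have hbind (m : M) : (Gen.bind fun ks => (Enc ks.1 m).bind (k ks.1)) =
      (P m).bind fun a => k a.1 a.2 := by
    simp only [P, PMF.bind_bind, PMF.bind_map]
    rfl
  have hmap (m : M) (g : PK × C → Bool) :
      (Gen.bind fun ks => (Enc ks.1 m).map fun c => g (ks.1, c)) = (P m).map g := by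
    simp only [P, PMF.map_bind, PMF.map_comp]
    rfl
  have key (a b : M) : (((P a).bind fun y => k y.1 y.2) true).toReal -
      (((P b).bind fun y => k y.1 y.2) true).toReal ≤ ε := by
    obtain ⟨g, hg⟩ := (P a).exists_map_sub_ge_bind_sub (P b) fun y => k y.1 y.2
    have hs := h b a g
    rw [cpaAdv, hmap, hmap] at hs
    exact hg.trans ((le_abs_self _).trans hs)
  rw [hbind, hbind, abs_sub_le_iff]
  exact ⟨key m1 m0, key m0 m1⟩

/-- Swapping two independently encrypted messages is a two-step hybrid. -/
theorem CPASecure.abs_swap_sub_le {PK SK M C : Type*} {Gen : PMF (PK × SK)}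
    {Enc : PK → M → PMF C} {ε : ℝ} (h : CPASecure Gen Enc ε) (D : PK × C × C → Bool) (x y : M) :
    |((Gen.bind fun ks => (Enc ks.1 y).bind fun c => (Enc ks.1 x).map fun d =>
        D (ks.1, c, d)) true).toReal -
      ((Gen.bind fun ks => (Enc ks.1 x).bind fun c => (Enc ks.1 y).map fun d =>
        D (ks.1, c, d)) true).toReal| ≤ 2 * ε := by
  have hfst := h.abs_bind_sub_le (fun pk c => (Enc pk y).map fun d => D (pk, c, d)) x y
  have hsnd := h.abs_bind_sub_le
    (fun pk d => (Enc pk y).bind fun c => PMF.pure (D (pk, c, d))) y x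
  have hcomm (pk : PK) (z : M) :
      ((Enc pk z).bind fun d => (Enc pk y).bind fun c => PMF.pure (D (pk, c, d))) =
        (Enc pk y).bind fun c => (Enc pk z).map fun d => D (pk, c, d) :=
    PMF.bind_comm _ _ _
  simp only [hcomm] at hsnd
  exact (abs_sub_le _ _ _).trans ((add_le_add hsnd hfst).trans_eq (two_mul ε).symm)

/-- The success probability in a hidden-bit game, in terms of its two branches. -/
theorem PMF.toReal_uniform_bool_bind (k : Bool → PMF Bool) :
    (((PMF.uniformOfFintype Bool).bind fun b => (k b).map fun d => d == b) true).toReal - 1 / 2 =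
      ((k true true).toReal - (k false true).toReal) / 2 := by
  have ht : ((k true).map fun d => d == true) = k true := by
    simpa [Function.id_def] using (k true).map_id
  have hf : ((k false).map fun d => d == false) = (k false).map not := by
    congr 1; funext d; cases d <;> rfl
  rw [PMF.toReal_bind_apply, tsum_bool, ht, hf, PMF.toReal_map_not_true]
  simp
  ring

/-- Double-layer swap game: if the outer scheme `(Gen1, Enc1, Dec1)` is `ε`-CPA-secure
then, in the experiment where `(pk1, sk1) ← Gen1`, `x ← Enc2 pk2 m`, `x' ← Enc2 pk2' m'`,
`c ← Enc1 pk1 x`, `c' ← Enc1 pk1 x'`, `b` is uniform, and the adversary observes `pk1`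
together with `(c, c')` if `b = false` and `(c', c)` if `b = true`, every adversary
`D : PK1 × C1 × C1 → Bool` satisfies `|Pr[D = b] − 1/2| ≤ ε`. -/
theorem double_layer_swap_game_hiding
    {PK1 SK1 C1 PK2 SK2 M2 C2 : Type*}
    (Gen1 : PMF (PK1 × SK1)) (Enc1 : PK1 → C2 → PMF C1) (Dec1 : SK1 → C1 → Option C2)
    (Gen2 : PMF (PK2 × SK2)) (Enc2 : PK2 → M2 → PMF C2) (Dec2 : SK2 → C2 → Option M2)
    (ε : ℝ) (hsec : CPASecure Gen1 Enc1 ε)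
    (pk2 pk2' : PK2) (m m' : M2) (D : PK1 × C1 × C1 → Bool) :
    |(((Gen1.bind fun ks =>
        (Enc2 pk2 m).bind fun x =>
        (Enc2 pk2' m').bind fun x' =>
        (Enc1 ks.1 x).bind fun c =>
        (Enc1 ks.1 x').bind fun c' =>
        (PMF.uniformOfFintype Bool).map fun b =>
          D (ks.1, if b then (c', c) else (c, c')) == b) true).toReal) - 1 / 2| ≤ ε := by
  rw [PMF.bind_comm]
  refine PMF.abs_toReal_bind_apply_sub_le _ _ _ fun x => ?_
  rw [PMF.bind_comm]
  refine PMF.abs_toReal_bind_apply_sub_le _ _ _ fun x' => ?_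
  let k (b : Bool) : PMF Bool := Gen1.bind fun ks => (Enc1 ks.1 x).bind fun c =>
    (Enc1 ks.1 x').map fun c' => D (ks.1, if b then (c', c) else (c, c'))
  have hgame : (Gen1.bind fun ks => (Enc1 ks.1 x).bind fun c => (Enc1 ks.1 x').bind fun c' =>
      (PMF.uniformOfFintype Bool).map fun b => D (ks.1, if b then (c', c) else (c, c')) == b) =
      (PMF.uniformOfFintype Bool).bind fun b => (k b).map fun d => d == b := by
    simp only [k, PMF.map_bind, PMF.map_comp]
    simp only [← PMF.bind_pure_comp, PMF.bind_comm (PMF.uniformOfFintype Bool)]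
    rfl
  have htrue : k true = Gen1.bind fun ks => (Enc1 ks.1 x').bind fun c =>
      (Enc1 ks.1 x).map fun d => D (ks.1, c, d) := by
    simp only [k, if_true, ← PMF.bind_pure_comp]
    congr 1
    funext ks
    exact PMF.bind_comm _ _ _
  have hfalse : k false = Gen1.bind fun ks => (Enc1 ks.1 x).bind fun c =>
      (Enc1 ks.1 x').map fun d => D (ks.1, c, d) := rfl
  rw [hgame, PMF.toReal_uniform_bool_bind, abs_div, abs_two, htrue, hfalse]
  linarith [hsec.abs_swap_sub_le D x x']
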